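/- arXiv:2604.04301 — 2 statements merged into one kernel-verified Lean document; each statement's English description precedes it below -/
import Mathlib

section
/- Let X ⊆ ℝ^n be closed with nonempty interior, Y ⊆ ℝ^m nonempty and open, Φ : X × Y → ℝ twice continuously differentiable on int(X) × Y and continuous relative to X × Y, and let g satisfy Assumption (G). Suppose g is prox-regular at x̄ ∈ int X for v̄ ∈ ∂g(x̄) with parameter r > 0, that ȳ ∈ Y satisfies (∂_Φ g)^{-1}(ȳ) = {x̄} and v̄ = ∇_x Φ(x̄, ȳ), and that ∇²_{xx}Φ(x̄, ȳ) is negative definite with λ_max(M) < r^{-1} for M := −(∇²_{xx}Φ(x̄, ȳ))^{-1}. Then there is ε > 0 such that, on a neighborhood of ȳ, the generalized proximal mapping satisfies (∂_Φ g)^{-1}(y) = {x ∈ ℝ^n : 0 ∈ T_ε(x) − ∇_x Φ(x, y)} and is single-valued and Lipschitz continuous there, where T_ε is a g-attentive ε-localization of ∂g at x̄ for v̄. -/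
set_option linter.unusedVariables false

open Filter Topology Metric Set Bornology
open scoped RealInnerProductSpace NNReal

noncomputable section

variable {E F : Type*} [NormedAddCommGroup E] [InnerProductSpace ℝ E] [CompleteSpace E]
  [NormedAddCommGroup F] [InnerProductSpace ℝ F] [CompleteSpace F]

/-- Gradient of the coupling `Φ` in its first argument. -/
def gradx (Φ : E → F → ℝ) (x : E) (y : F) : E :=
  gradient (fun x' => Φ x' y) x

/-- Gradient of the coupling `Φ` in its second argument. -/
def grady (Φ : E → F → ℝ) (x : E) (y : F) : F :=
  gradient (fun y' => Φ x y') y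

/-- The Φ-conjugate of `f` relative to `X`: `f^Φ(y) = sup_{x ∈ X} (Φ(x,y) − f(x))`. -/
def phiConj (X : Set E) (Φ : E → F → ℝ) (f : E → EReal) (y : F) : EReal :=
  ⨆ x ∈ X, ((Φ x y : EReal) - f x)

/-- The Φ-biconjugate of `f`: `f^{ΦΦ}(x) = sup_{y ∈ Y} (Φ(x,y) − f^Φ(y))`. -/
def phiBiconj (X : Set E) (Y : Set F) (Φ : E → F → ℝ) (f : E → EReal) (x : E) : EReal :=
  ⨆ y ∈ Y, ((Φ x y : EReal) - phiConj X Φ f y)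

/-- `f` is Φ-convex on `X`: `f` is a pointwise supremum over `X` of functions
`x ↦ Φ(x, yᵢ) − βᵢ` with `yᵢ ∈ Y` (the empty index set giving `f ≡ −∞`). -/
def PhiConvexOn (X : Set E) (Y : Set F) (Φ : E → F → ℝ) (f : E → EReal) : Prop :=
  ∃ (ι : Type) (yi : ι → F) (βi : ι → EReal),
    (∀ i, yi i ∈ Y) ∧ ∀ x ∈ X, f x = ⨆ i, ((Φ x (yi i) : EReal) - βi i)

/-- The Φ-subdifferential of `f` at `xb`:
`y ∈ ∂_Φ f(xb)` iff `y ∈ Y` and `f(x) ≥ f(xb) + Φ(x,y) − Φ(xb,y)` for all `x ∈ X`. -/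
def phiSubdiff (X : Set E) (Y : Set F) (Φ : E → F → ℝ) (f : E → EReal) (xb : E) : Set F :=
  {y | y ∈ Y ∧ ∀ x ∈ X, f xb + ((Φ x y - Φ xb y : ℝ) : EReal) ≤ f x}

/-- The Φ-subdifferential of a function `gc` on `Y` (such as `f^Φ`) at `yb`:
`x ∈ ∂_Φ gc(yb)` iff `x ∈ X` and `gc(y) ≥ gc(yb) + Φ(x,y) − Φ(x,yb)` for all `y ∈ Y`. -/
def phiSubdiffDual (X : Set E) (Y : Set F) (Φ : E → F → ℝ) (gc : F → EReal) (yb : F) : Set E :=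
  {x | x ∈ X ∧ ∀ y ∈ Y, gc yb + ((Φ x y - Φ x yb : ℝ) : EReal) ≤ gc y}

/-- The generalized proximal mapping `(∂_Φ g)^{-1}(y) = argmin_{x ∈ X} (g(x) − Φ(x,y))`. -/
def proxSet (X : Set E) (Φ : E → F → ℝ) (g : E → EReal) (y : F) : Set E :=
  {x | x ∈ X ∧ ∀ x' ∈ X, g x - ((Φ x y : ℝ) : EReal) ≤ g x' - ((Φ x' y : ℝ) : EReal)}

/-- Assumption (G): `g` is proper and lsc on `X`, `g − Φ(·,y)` is level-bounded in `x`
locally uniformly in `y`, and the range of the generalized proximal mapping lies in `int X`. -/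
structure AssumptionG (X : Set E) (Y : Set F) (Φ : E → F → ℝ) (g : E → EReal) : Prop where
  proper : ∃ x ∈ X, g x ≠ ⊤
  ne_bot : ∀ x, g x ≠ ⊥
  lsc : LowerSemicontinuousOn g X
  levelBounded : ∀ yb ∈ Y, ∀ α : ℝ, ∃ V ∈ 𝓝 yb, ∃ B : Set E, IsBounded B ∧
    ∀ y ∈ V ∩ Y, {x | x ∈ X ∧ g x - ((Φ x y : ℝ) : EReal) ≤ (α : EReal)} ⊆ B
  ran_interior : ∀ y ∈ Y, proxSet X Φ g y ⊆ interior X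

/-- `v` is a regular (Fréchet) subgradient of `f` at `x`. -/
def IsFSubgrad (f : E → EReal) (x v : E) : Prop :=
  f x ≠ ⊤ ∧ f x ≠ ⊥ ∧ ∀ ε > (0 : ℝ), ∃ δ > (0 : ℝ), ∀ x', ‖x' - x‖ < δ →
    f x + ((⟪v, x' - x⟫ - ε * ‖x' - x‖ : ℝ) : EReal) ≤ f x'

/-- `v` is a limiting (Mordukhovich) subgradient of `f` at `x`. -/
def IsLSubgrad (f : E → EReal) (x v : E) : Prop :=
  f x ≠ ⊤ ∧ f x ≠ ⊥ ∧ ∃ xs vs : ℕ → E,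
    Tendsto xs atTop (𝓝 x) ∧ Tendsto (fun ν => f (xs ν)) atTop (𝓝 (f x)) ∧
    Tendsto vs atTop (𝓝 v) ∧ ∀ ν, IsFSubgrad f (xs ν) (vs ν)

/-- `f` is locally lower semicontinuous at `xb`. -/
def LocallyLscAt (f : E → EReal) (xb : E) : Prop :=
  ∃ ε > (0 : ℝ), ∀ α : EReal, α ≤ f xb + ((ε : ℝ) : EReal) →
    IsClosed {x | x ∈ closedBall xb ε ∧ f x ≤ α}

/-- `g` is prox-regular at `xb` for `vb` with parameter `r`. -/
def ProxRegularAt (g : E → EReal) (xb vb : E) (r : ℝ) : Prop :=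
  g xb ≠ ⊤ ∧ g xb ≠ ⊥ ∧ LocallyLscAt g xb ∧ IsLSubgrad g xb vb ∧
  ∃ ε > (0 : ℝ), ∀ x x' v : E, ‖x' - xb‖ ≤ ε → ‖x - xb‖ ≤ ε →
    g x ≤ g xb + ((ε : ℝ) : EReal) → IsLSubgrad g x v → ‖v - vb‖ ≤ ε →
    g x + ((⟪v, x' - x⟫ - r / 2 * ‖x' - x‖ ^ 2 : ℝ) : EReal) ≤ g x'

/-- `g` is Φ-prox-regular at `xb` for `(vb, yb)`. -/
def PhiProxRegularAt (X : Set E) (Φ : E → F → ℝ) (g : E → EReal)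
    (xb vb : E) (yb : F) : Prop :=
  g xb ≠ ⊤ ∧ g xb ≠ ⊥ ∧ LocallyLscAt g xb ∧ IsLSubgrad g xb vb ∧
  ∃ ε > (0 : ℝ), ∀ (x x' v : E) (y : F), ‖x' - xb‖ ≤ ε → ‖x - xb‖ ≤ ε →
    g x - g xb ≤ ((ε : ℝ) : EReal) → IsLSubgrad g x v → ‖v - vb‖ ≤ ε → ‖y - yb‖ ≤ ε →
    v = gradx Φ x y →
    g x + ((Φ x' y - Φ x y : ℝ) : EReal) ≤ g x'

/-- `g` is Φ-prox-regular at `xb` for `(vb, yb)` with the subgradient inequality strict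
whenever `x' ≠ x`. -/
def PhiProxRegularStrictAt (X : Set E) (Φ : E → F → ℝ) (g : E → EReal)
    (xb vb : E) (yb : F) : Prop :=
  PhiProxRegularAt X Φ g xb vb yb ∧
  ∃ ε > (0 : ℝ), ∀ (x x' v : E) (y : F), ‖x' - xb‖ ≤ ε → ‖x - xb‖ ≤ ε →
    g x - g xb ≤ ((ε : ℝ) : EReal) → IsLSubgrad g x v → ‖v - vb‖ ≤ ε → ‖y - yb‖ ≤ ε →
    v = gradx Φ x y → x' ≠ x →
    g x + ((Φ x' y - Φ x y : ℝ) : EReal) < g x'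

/-- The `g`-attentive `ε`-localization of the limiting subdifferential `∂g` at `xb` for `vb`. -/
def gAttentiveLoc (g : E → EReal) (xb vb : E) (ε : ℝ) (x : E) : Set E :=
  {v | ‖x - xb‖ < ε ∧ g x < g xb + ((ε : ℝ) : EReal) ∧ IsLSubgrad g x v ∧ ‖v - vb‖ < ε}

/-- `Φ` is twist: for each `x ∈ int X` the map `y ↦ ∇ₓΦ(x,y)` is injective on `Y`. -/
def IsTwist (X : Set E) (Y : Set F) (Φ : E → F → ℝ) : Prop :=
  ∀ x ∈ interior X, Set.InjOn (fun y => gradx Φ x y) Y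

/-- `Φ` is a local strong twist at `(xb, yb)`: with `vb := ∇ₓΦ(xb,yb)` there is a unique
continuously differentiable map `G(x,v)` near `(xb,vb)`, with values in `Y`, such that
`G(xb,vb) = yb` and `∇ₓΦ(x, G(x,v)) = v` near `(xb,vb)`. -/
def IsLocalStrongTwist (Y : Set F) (Φ : E → F → ℝ) (xb : E) (yb : F) : Prop :=
  ∃ (G : E × E → F) (U : Set (E × E)), IsOpen U ∧ (xb, gradx Φ xb yb) ∈ U ∧
    ContDiffOn ℝ 1 G U ∧ G (xb, gradx Φ xb yb) = yb ∧ (∀ p ∈ U, G p ∈ Y) ∧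
    (∀ p ∈ U, gradx Φ p.1 (G p) = p.2) ∧
    ∀ (G' : E × E → F) (U' : Set (E × E)), IsOpen U' → (xb, gradx Φ xb yb) ∈ U' →
      ContDiffOn ℝ 1 G' U' → G' (xb, gradx Φ xb yb) = yb → (∀ p ∈ U', G' p ∈ Y) →
      (∀ p ∈ U', gradx Φ p.1 (G' p) = p.2) →
      ∀ᶠ p in 𝓝 (xb, gradx Φ xb yb), G' p = G p

/-- `Φ` is a global strong twist. -/
def IsGlobalStrongTwist (X : Set E) (Y : Set F) (Φ : E → F → ℝ) : Prop :=
  IsTwist X Y Φ ∧ ∀ xb ∈ interior X, ∀ yb ∈ Y, IsLocalStrongTwist Y Φ xb yb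

/-- `σ` is a single-valued localization of the set-valued map `Fm` around `pb` for `qb`,
with domain of localization `U`. -/
def IsSVLocalization {α β : Type*} [TopologicalSpace α] [TopologicalSpace β]
    (Fm : α → Set β) (pb : α) (qb : β) (σ : α → β) (U : Set α) : Prop :=
  U ∈ 𝓝 pb ∧ σ pb = qb ∧ ∃ V ∈ 𝓝 qb, ∀ p ∈ U, Fm p ∩ V = {σ p}

/-- `H` is a first-order approximation to `Fm` at `xb`. -/
def IsFOApprox {α β : Type*} [NormedAddCommGroup α] [NormedAddCommGroup β]
    (Fm H : α → β) (xb : α) : Prop :=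
  H xb = Fm xb ∧ ∀ ε > (0 : ℝ), ∃ V ∈ 𝓝 xb, ∀ x ∈ V, ‖Fm x - H x‖ ≤ ε * ‖x - xb‖

/-- `H` is a strict first-order approximation to `Fm` at `xb`. -/
def IsStrictFOApprox {α β : Type*} [NormedAddCommGroup α] [NormedAddCommGroup β]
    (Fm H : α → β) (xb : α) : Prop :=
  H xb = Fm xb ∧ ∀ ε > (0 : ℝ), ∃ V ∈ 𝓝 xb, ∀ x ∈ V, ∀ x' ∈ V,
    ‖Fm x - H x - (Fm x' - H x')‖ ≤ ε * ‖x - x'‖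

/-- Sequential epi-convergence of `fs` to `f`. -/
def EpiConvergesSeq (fs : ℕ → E → EReal) (f : E → EReal) : Prop :=
  ∀ w : E,
    (∀ ws : ℕ → E, Tendsto ws atTop (𝓝 w) →
      f w ≤ Filter.liminf (fun ν => fs ν (ws ν)) atTop) ∧
    (∃ ws : ℕ → E, Tendsto ws atTop (𝓝 w) ∧
      Filter.limsup (fun ν => fs ν (ws ν)) atTop ≤ f w)

/-- `g` is strictly twice epi-differentiable at `xb` for `vb`: the second-order difference
quotients epi-converge to a common limit along every sequence `tₙ ↘ 0`,
`(xₙ, vₙ) → (xb, vb)` with `vₙ ∈ ∂g(xₙ)` and `g(xₙ) → g(xb)`. -/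
def StrictTwiceEpiDiff (g : E → EReal) (xb vb : E) : Prop :=
  ∃ h : E → EReal, ∀ (ts : ℕ → ℝ) (xs vs : ℕ → E),
    (∀ ν, 0 < ts ν) → Tendsto ts atTop (𝓝 0) →
    Tendsto xs atTop (𝓝 xb) → Tendsto vs atTop (𝓝 vb) →
    (∀ ν, IsLSubgrad g (xs ν) (vs ν)) →
    Tendsto (fun ν => g (xs ν)) atTop (𝓝 (g xb)) →
    EpiConvergesSeq (fun ν w =>
      ((2 / (ts ν) ^ 2 : ℝ) : EReal) *
        (g (xs ν + ts ν • w) - g (xs ν) - ((ts ν * ⟪vs ν, w⟫ : ℝ) : EReal))) h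

/-- `g` is prox-bounded with threshold `lamg`. -/
def ProxBoundedWith (g : E → EReal) (lamg : ℝ) : Prop :=
  ∀ lam : ℝ, 0 < lam → lam < lamg → ∃ (y : E) (b : ℝ), ∀ x : E,
    (b : EReal) ≤ g x + ((1 / (2 * lam) * ‖x - y‖ ^ 2 : ℝ) : EReal)

/-- `φ` is lower-C¹ on the open set `O`: locally a max over a compact index set `Z`
of functions `h(x, ·)` that are continuous in `(x,y)` together with their `y`-gradients. -/
def LowerC1On (φ : F → ℝ) (O : Set F) : Prop :=
  ∀ y₀ ∈ O, ∃ (V : Set F) (Z : Set E) (h : E → F → ℝ) (hy : E → F → F),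
    V ∈ 𝓝 y₀ ∧ IsCompact Z ∧ Z.Nonempty ∧
    ContinuousOn (fun p : E × F => h p.1 p.2) (Z ×ˢ V) ∧
    ContinuousOn (fun p : E × F => hy p.1 p.2) (Z ×ˢ V) ∧
    (∀ x ∈ Z, ∀ y ∈ V, HasGradientAt (h x) (hy x y) y) ∧
    ∀ y ∈ V, (∃ x ∈ Z, φ y = h x y) ∧ ∀ x ∈ Z, h x y ≤ φ y

set_option linter.unusedSectionVars false

/-! ### Existence and outer semicontinuity of the generalized proximal mapping -/

lemma le_of_mem_proxSet {X : Set E} {Φ : E → F → ℝ} {g : E → EReal} {x x₀ : E} {y : F} {γ : ℝ}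
    (hx : x ∈ proxSet X Φ g y) (hx₀ : x₀ ∈ X) (hγ : g x₀ = (γ : EReal)) :
    g x ≤ ((γ + (Φ x y - Φ x₀ y) : ℝ) : EReal) := by
  have h := hx.2 x₀ hx₀
  rw [hγ, ← EReal.coe_sub, EReal.sub_le_iff_le_add (by simp) (by simp), ← EReal.coe_add] at h
  exact h.trans_eq (by congr 1; ring)

lemma ContinuousOn.coupling_left {X : Set E} {Y : Set F} {Φ : E → F → ℝ}
    (hΦ : ContinuousOn (fun p : E × F => Φ p.1 p.2) (X ×ˢ Y)) {y : F} (hy : y ∈ Y) :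
    ContinuousOn (fun x => Φ x y) X :=
  hΦ.comp (f := fun x => (x, y)) (by fun_prop) fun _ hx => ⟨hx, hy⟩

lemma ContinuousOn.coupling_right {X : Set E} {Y : Set F} {Φ : E → F → ℝ}
    (hΦ : ContinuousOn (fun p : E × F => Φ p.1 p.2) (X ×ˢ Y)) {x : E} (hx : x ∈ X) :
    ContinuousOn (fun y => Φ x y) Y :=
  hΦ.comp (f := fun y => (x, y)) (by fun_prop) fun _ hy => ⟨hx, hy⟩

lemma AssumptionG.lowerSemicontinuousOn_sub {X : Set E} {Y : Set F} {Φ : E → F → ℝ}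
    {g : E → EReal} (hG : AssumptionG X Y Φ g)
    (hΦ : ContinuousOn (fun p : E × F => Φ p.1 p.2) (X ×ˢ Y)) {y : F} (hy : y ∈ Y) :
    LowerSemicontinuousOn (fun x => g x - ((Φ x y : ℝ) : EReal)) X := by
  have hc : ContinuousOn (fun x => ((-Φ x y : ℝ) : EReal)) X :=
    continuous_coe_real_ereal.comp_continuousOn (hΦ.coupling_left hy).neg
  have h := hG.lsc.add' hc.lowerSemicontinuousOn fun x _ =>
    EReal.continuousAt_add (Or.inr (EReal.coe_ne_bot _)) (Or.inr (EReal.coe_ne_top _))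
  simpa only [EReal.coe_neg, ← sub_eq_add_neg] using h

lemma AssumptionG.exists_isBounded_proxSet [ProperSpace E] {X : Set E} {Y : Set F}
    {Φ : E → F → ℝ} {g : E → EReal} (hG : AssumptionG X Y Φ g) (hX : IsClosed X) (hY : IsOpen Y)
    (hΦ : ContinuousOn (fun p : E × F => Φ p.1 p.2) (X ×ˢ Y)) {yb : F} (hyb : yb ∈ Y) :
    ∃ B : Set E, IsBounded B ∧
      ∀ᶠ y in 𝓝 yb, (proxSet X Φ g y).Nonempty ∧ proxSet X Φ g y ⊆ B := by
  obtain ⟨x₀, hx₀, hx₀t⟩ := hG.proper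
  obtain ⟨γ, hγ⟩ : ∃ γ : ℝ, g x₀ = γ :=
    ⟨(g x₀).toReal, (EReal.coe_toReal hx₀t (hG.ne_bot x₀)).symm⟩
  obtain ⟨V, hV, B, hB, hVB⟩ := hG.levelBounded yb hyb (γ - Φ x₀ yb + 1)
  obtain ⟨R, hR⟩ := hB.subset_closedBall x₀
  refine ⟨B, hB, ?_⟩
  have hYn : Y ∈ 𝓝 yb := hY.mem_nhds hyb
  have hval : ∀ᶠ y in 𝓝 yb, γ - Φ x₀ y < γ - Φ x₀ yb + 1 :=
    (continuousAt_const.sub ((hΦ.coupling_right hx₀).continuousAt hYn)).eventually_lt_const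
      (by simp)
  filter_upwards [hV, hYn, hval] with y hyV hyY hy
  have hle : g x₀ - ((Φ x₀ y : ℝ) : EReal) ≤ ((γ - Φ x₀ yb + 1 : ℝ) : EReal) := by
    rw [hγ, ← EReal.coe_sub, EReal.coe_le_coe_iff]
    exact hy.le
  have hmem : x₀ ∈ B := hVB y ⟨hyV, hyY⟩ ⟨hx₀, hle⟩
  refine ⟨?_, fun x hx => hVB y ⟨hyV, hyY⟩ ⟨hx.1, (hx.2 x₀ hx₀).trans hle⟩⟩
  have hK : IsCompact (X ∩ closedBall x₀ R) := (isCompact_closedBall x₀ R).inter_left hX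
  obtain ⟨a, ha, hmin⟩ := LowerSemicontinuousOn.exists_isMinOn (s := X ∩ closedBall x₀ R)
    ⟨x₀, hx₀, hR hmem⟩ hK
    ((hG.lowerSemicontinuousOn_sub hΦ hyY).mono inter_subset_left)
  refine ⟨a, ha.1, fun x hx => ?_⟩
  by_cases hxB : x ∈ B
  · exact hmin ⟨hx, hR hxB⟩
  · refine (hmin ⟨hx₀, hR hmem⟩).trans (hle.trans ?_)
    by_contra! h
    exact hxB (hVB y ⟨hyV, hyY⟩ ⟨hx, h.le⟩)

lemma AssumptionG.eventually_proxSet_subset [ProperSpace E] {X : Set E} {Y : Set F}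
    {Φ : E → F → ℝ} {g : E → EReal} (hG : AssumptionG X Y Φ g) (hX : IsClosed X) (hY : IsOpen Y)
    (hΦ : ContinuousOn (fun p : E × F => Φ p.1 p.2) (X ×ˢ Y)) {xb : E} {yb : F} (hyb : yb ∈ Y)
    {γ : ℝ} (hγ : g xb = γ) (hprox : proxSet X Φ g yb = {xb}) {N : Set E} (hN : N ∈ 𝓝 xb) :
    ∀ᶠ y in 𝓝 yb, proxSet X Φ g y ⊆ N := by
  obtain ⟨B, hB, hBy⟩ := hG.exists_isBounded_proxSet hX hY hΦ hyb
  have hxb : xb ∈ proxSet X Φ g yb := by simp [hprox]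
  have hK : IsCompact (closure B \ interior N) := hB.isCompact_closure.diff isOpen_interior
  have hfar : ∀ x ∈ closure B \ interior N,
      ∀ᶠ z : F × E in 𝓝 (yb, x), z.2 ∉ proxSet X Φ g z.1 := by
    rintro x ⟨-, hxN⟩
    by_cases hxX : x ∉ X
    · have : Xᶜ ∈ 𝓝 x := hX.isOpen_compl.mem_nhds hxX
      filter_upwards [continuous_snd.continuousAt.preimage_mem_nhds this] with z hz hzp
      exact hz hzp.1
    push Not at hxX
    have hxne : x ≠ xb := fun h => hxN (h ▸ mem_interior_iff_mem_nhds.2 hN)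
    have hlt : ((γ + (Φ x yb - Φ xb yb) : ℝ) : EReal) < g x := by
      by_contra! hle
      refine hxne ((Set.ext_iff.1 hprox x).1 ⟨hxX, fun x' hx' => le_trans ?_ (hxb.2 x' hx')⟩)
      rw [hγ, ← EReal.coe_sub, EReal.sub_le_iff_le_add (by simp) (by simp), ← EReal.coe_add]
      exact hle.trans_eq (by congr 1; ring)
    obtain ⟨c, hc₁, hc₂⟩ := EReal.lt_iff_exists_real_btwn.1 hlt
    have hcont : ContinuousWithinAt
        (fun z : F × E => γ + (Φ z.2 z.1 - Φ xb z.1)) (Y ×ˢ X) (yb, x) := by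
      refine continuousWithinAt_const.add (.sub ?_ ?_)
      · exact hΦ.comp (s := Y ×ˢ X) (f := fun z : F × E => (z.2, z.1))
          (by fun_prop) (fun z hz => ⟨hz.2, hz.1⟩) (yb, x) ⟨hyb, hxX⟩
      · exact (hΦ.coupling_right hxb.1).comp (s := Y ×ˢ X) (f := fun z : F × E => z.1)
          (by fun_prop) (fun z hz => hz.1) (yb, x) ⟨hyb, hxX⟩
    have h₁ := hcont.eventually_lt_const (EReal.coe_lt_coe_iff.1 hc₁)
    have h₂ : ∀ᶠ z : F × E in 𝓝[Y ×ˢ X] (yb, x), (c : EReal) < g z.2 := by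
      have : Tendsto (fun z : F × E => z.2) (𝓝[Y ×ˢ X] (yb, x)) (𝓝[X] x) :=
        (continuous_snd.continuousWithinAt).tendsto_nhdsWithin fun z hz => hz.2
      exact this.eventually (hG.lsc x hxX _ hc₂)
    have h₃ : ∀ᶠ z : F × E in 𝓝 (yb, x), z.1 ∈ Y :=
      continuous_fst.continuousAt.preimage_mem_nhds (hY.mem_nhds hyb)
    filter_upwards [eventually_nhdsWithin_iff.1 (h₁.and h₂), h₃] with z hz hzY hzp
    obtain ⟨hz₁, hz₂⟩ := hz ⟨hzY, hzp.1⟩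
    exact (hz₂.trans_le (le_of_mem_proxSet hzp hxb.1 hγ)).not_gt (EReal.coe_lt_coe_iff.2 hz₁)
  filter_upwards [hBy, hK.eventually_forall_of_forall_eventually
    (P := fun y x => x ∉ proxSet X Φ g y) hfar] with y hy hfar' x hx
  by_contra hxN
  exact hfar' x ⟨subset_closure (hy.2 hx), fun h => hxN (interior_subset h)⟩ hx

/-! ### First-order optimality -/

lemma IsFSubgrad.isLSubgrad {f : E → EReal} {x v : E} (h : IsFSubgrad f x v) :
    IsLSubgrad f x v :=
  ⟨h.1, h.2.1, fun _ => x, fun _ => v, tendsto_const_nhds, tendsto_const_nhds,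
    tendsto_const_nhds, fun _ => h⟩

lemma isFSubgrad_gradx_of_mem_proxSet {X : Set E} {Φ : E → F → ℝ} {g : E → EReal} {x : E} {y : F}
    (hx : x ∈ proxSet X Φ g y) (hxX : x ∈ interior X) (htop : g x ≠ ⊤) (hbot : g x ≠ ⊥)
    (hd : DifferentiableAt ℝ (fun x' => Φ x' y) x) :
    IsFSubgrad g x (gradx Φ x y) := by
  refine ⟨htop, hbot, fun ε hε => ?_⟩
  have hgrad : HasFDerivAt (fun x' => Φ x' y) (InnerProductSpace.toDual ℝ E (gradx Φ x y)) x :=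
    hd.hasGradientAt.hasFDerivAt
  have hev := (hgrad.isLittleO.def hε).and (mem_interior_iff_mem_nhds.1 hxX)
  obtain ⟨δ, hδ, hball⟩ := Metric.eventually_nhds_iff.1 hev
  refine ⟨δ, hδ, fun x' hx' => ?_⟩
  obtain ⟨hlin, hx'X⟩ := hball (by rwa [dist_eq_norm])
  obtain ⟨γ, hγ⟩ : ∃ γ : ℝ, g x = γ := ⟨(g x).toReal, (EReal.coe_toReal htop hbot).symm⟩
  have hopt := hx.2 x' hx'X
  have hle : g x + ((Φ x' y - Φ x y : ℝ) : EReal) ≤ g x' := by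
    rw [hγ] at hopt ⊢
    rw [← EReal.coe_sub, EReal.le_sub_iff_add_le (by simp) (by simp), ← EReal.coe_add] at hopt
    rw [← EReal.coe_add]
    exact le_trans (le_of_eq (by congr 1; ring)) hopt
  refine le_trans (add_le_add_right (EReal.coe_le_coe_iff.2 ?_) _) hle
  rw [InnerProductSpace.toDual_apply_apply] at hlin
  have := (abs_le.1 (Real.norm_eq_abs _ ▸ hlin)).1
  linarith

/-! ### Second-order estimates for the coupling -/

lemma inner_le_neg_mul_of_comp_eq_neg_id {A M : E →L[ℝ] E}
    (hsymm : ∀ u v, ⟪A u, v⟫ = ⟪u, A v⟫) (hneg : ∀ u, ⟪A u, u⟫ ≤ 0)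
    (hAM : A.comp M = -ContinuousLinearMap.id ℝ E) {l s : ℝ}
    (hl : ∀ u, ⟪M u, u⟫ ≤ l * ‖u‖ ^ 2) (hs : 0 ≤ s) (hsl : s * l ≤ 1) (u : E) :
    ⟪A u, u⟫ ≤ -s * ‖u‖ ^ 2 := by
  have hAMu : A (M u) = -u := by simpa using DFunLike.congr_fun hAM u
  have h := hneg (u - s • M u)
  have h₁ : ⟪A u, M u⟫ = -‖u‖ ^ 2 := by
    rw [hsymm, hAMu, inner_neg_right, real_inner_self_eq_norm_sq]
  rw [map_sub, map_smul, hAMu] at h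
  simp only [inner_sub_left, inner_sub_right, inner_smul_left, inner_smul_right, smul_neg,
    inner_neg_left, h₁, real_inner_self_eq_norm_sq, real_inner_comm (M u) u,
    RCLike.conj_to_real] at h
  have h₂ := mul_le_mul_of_nonneg_left (hl u) (mul_nonneg hs hs)
  have h₃ := mul_le_mul_of_nonneg_right hsl (mul_nonneg hs (sq_nonneg ‖u‖))
  have h₄ := real_inner_comm (M u) u
  nlinarith

lemma contDiffAt_gradx {Φ : E → F → ℝ} {x : E} {y : F}
    (h : ContDiffAt ℝ 2 (fun p : E × F => Φ p.1 p.2) (x, y)) :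
    ContDiffAt ℝ 1 (fun p : E × F => gradx Φ p.1 p.2) (x, y) := by
  let T : (E →L[ℝ] ℝ) →ₗᵢ[ℝ] E :=
    { toFun := (InnerProductSpace.toDual ℝ E).symm
      map_add' := map_add _
      map_smul' := fun c L => by simp
      norm_map' := fun L => by simp }
  have heq : (fun p : E × F => gradx Φ p.1 p.2) =ᶠ[𝓝 (x, y)] fun p =>
      T ((fderiv ℝ (fun p : E × F => Φ p.1 p.2) p).comp (ContinuousLinearMap.inl ℝ E F)) := by
    filter_upwards [h.eventually (by simp)] with p hp
    have hd := (hp.differentiableAt (by simp)).hasFDerivAt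
    have := hd.comp (f := fun x' : E => (x', p.2)) p.1 (hasFDerivAt_prodMk_left p.1 p.2)
    exact congrArg (InnerProductSpace.toDual ℝ E).symm this.fderiv
  refine ContDiffAt.congr_of_eventuallyEq ?_ heq
  exact T.contDiff.contDiffAt.comp _
    ((h.fderiv_right (m := 1) (by norm_num)).clm_comp contDiffAt_const)

lemma inner_fderiv_gradx_comm {Φ : E → F → ℝ} {x : E} {y : F}
    (h : ContDiffAt ℝ 2 (fun x' => Φ x' y) x)
    (hd : DifferentiableAt ℝ (fun x' => gradx Φ x' y) x) (u v : E) :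
    ⟪fderiv ℝ (fun x' => gradx Φ x' y) x u, v⟫ = ⟪u, fderiv ℝ (fun x' => gradx Φ x' y) x v⟫ := by
  have key : ∀ u v, ⟪fderiv ℝ (fun x' => gradx Φ x' y) x u, v⟫
      = fderiv ℝ (fderiv ℝ fun x' => Φ x' y) x u v := by
    intro u v
    have h₁ : (fun x' => ⟪gradx Φ x' y, v⟫) = fun x' => fderiv ℝ (fun x' => Φ x' y) x' v := by
      funext x'
      exact InnerProductSpace.toDual_symm_apply
    have h₂ := congrArg (fun f => fderiv ℝ f x u) h₁
    have h₃ : DifferentiableAt ℝ (fderiv ℝ fun x' => Φ x' y) x :=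
      (h.fderiv_right (m := 1) (by norm_num)).differentiableAt (by simp)
    simpa [fderiv_inner_apply, hd, h₃, fderiv_clm_apply] using h₂
  rw [key, real_inner_comm, key]
  exact h.isSymmSndFDerivAt (by simp) u v

/-- A strictly differentiable `G` with `⟪∂ₓG u, u⟫ ≤ -s‖u‖²` is locally strongly monotone
decreasing in `x`, with any modulus below `s`, and locally Lipschitz in `y`. -/
lemma HasStrictFDerivAt.eventually_inner_sub_le {G : E × F → E} {G' : E × F →L[ℝ] E} {p₀ : E × F}
    (hG : HasStrictFDerivAt G G' p₀) {s t : ℝ} (hts : t < s)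
    (hs : ∀ u, ⟪G' (u, 0), u⟫ ≤ -s * ‖u‖ ^ 2) :
    ∃ δ > 0, ∃ L : ℝ≥0, ∀ x x' : E, ∀ y y' : F, ‖x - p₀.1‖ < δ → ‖x' - p₀.1‖ < δ →
      ‖y - p₀.2‖ < δ → ‖y' - p₀.2‖ < δ →
      ⟪G (x, y) - G (x', y'), x - x'⟫ ≤ -t * ‖x - x'‖ ^ 2 + L * ‖y - y'‖ * ‖x - x'‖ := by
  obtain ⟨L, S, hS, hL⟩ := hG.exists_lipschitzOnWith
  have h₁ := hG.isLittleO.def (sub_pos.2 hts)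
  obtain ⟨S', hS'o, hS'p, hlin⟩ := exists_nhds_square h₁
  obtain ⟨δ, hδ, hball⟩ := Metric.mem_nhds_iff.1 (Filter.inter_mem hS (hS'o.mem_nhds hS'p))
  refine ⟨δ, hδ, L, fun x x' y y' hx hx' hy hy' => ?_⟩
  have hmem : ∀ x y, ‖x - p₀.1‖ < δ → ‖y - p₀.2‖ < δ → (x, y) ∈ S ∩ S' := fun x y hx hy =>
    hball (by rw [mem_ball, Prod.dist_eq, dist_eq_norm, dist_eq_norm]; exact max_lt hx hy)
  have hA := hlin (mk_mem_prod (hmem x y hx hy).2 (hmem x' y hx' hy).2)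
  have hB := hL.norm_sub_le (hmem x' y hx' hy).1 (hmem x' y' hx' hy').1
  simp only [mem_ofPred_eq, Prod.mk_sub_mk, sub_self, Prod.norm_mk, norm_zero, norm_nonneg, sup_of_le_left,
    sup_of_le_right] at hA hB
  have hA' := (real_inner_le_norm (G (x, y) - G (x', y) - G' (x - x', 0)) (x - x')).trans
    (mul_le_mul_of_nonneg_right hA (norm_nonneg _))
  have hB' := (real_inner_le_norm (G (x', y) - G (x', y')) (x - x')).trans
    (mul_le_mul_of_nonneg_right hB (norm_nonneg _))
  have hs' := hs (x - x')
  have hsplit : G (x, y) - G (x', y') = (G (x, y) - G (x', y) - G' (x - x', 0))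
      + G' (x - x', 0) + (G (x', y) - G (x', y')) := by abel
  rw [hsplit, inner_add_left, inner_add_left]
  nlinarith

/-! ### Monotonicity coming from prox-regularity -/

lemma ProxRegularAt.exists_le_inner {g : E → EReal} {xb vb : E} {r : ℝ}
    (h : ProxRegularAt g xb vb r) :
    ∃ ε₀ > 0, ∀ ε ≤ ε₀, ∀ x x' v v' : E, v ∈ gAttentiveLoc g xb vb ε x →
      v' ∈ gAttentiveLoc g xb vb ε x' → -r * ‖x - x'‖ ^ 2 ≤ ⟪v - v', x - x'⟫ := by
  obtain ⟨-, -, -, -, ε₀, hε₀, hpr⟩ := h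
  refine ⟨ε₀, hε₀, fun ε hε x x' v v' hv hv' => ?_⟩
  have hstep : ∀ x x' v v' : E, v ∈ gAttentiveLoc g xb vb ε x →
      v' ∈ gAttentiveLoc g xb vb ε x' →
      g x + ((⟪v, x' - x⟫ - r / 2 * ‖x' - x‖ ^ 2 : ℝ) : EReal) ≤ g x' := fun x x' v v' hv hv' =>
    hpr x x' v (hv'.1.le.trans hε) (hv.1.le.trans hε)
      (hv.2.1.le.trans (add_le_add_right (EReal.coe_le_coe_iff.2 hε) _)) hv.2.2.1
      (hv.2.2.2.le.trans hε)
  have h₁ := hstep x x' v v' hv hv'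
  have h₂ := hstep x' x v' v hv' hv
  rw [← EReal.coe_toReal hv.2.2.1.1 hv.2.2.1.2.1,
    ← EReal.coe_toReal hv'.2.2.1.1 hv'.2.2.1.2.1, ← EReal.coe_add, EReal.coe_le_coe_iff] at h₁ h₂
  rw [norm_sub_rev x' x, ← neg_sub x x', inner_neg_right] at h₁
  rw [inner_sub_left]
  linarith

/-- If `∂g` is locally hypomonotone with modulus `r` and `∇ₓΦ` is locally strongly monotone
decreasing in `x` with modulus exceeding `r`, then solutions of `∇ₓΦ(x, y) ∈ T_ε(x)` depend
Lipschitz continuously on `y`. -/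
lemma ProxRegularAt.exists_gAttentiveLoc_lipschitz {Φ : E → F → ℝ} {g : E → EReal} {xb vb : E}
    {r : ℝ} (h : ProxRegularAt g xb vb r) {yb : F} {G' : E × F →L[ℝ] E}
    (hG : HasStrictFDerivAt (fun p : E × F => gradx Φ p.1 p.2) G' (xb, yb)) {s : ℝ} (hrs : r < s)
    (hs : ∀ u, ⟪G' (u, 0), u⟫ ≤ -s * ‖u‖ ^ 2) :
    ∃ ε > 0, ∃ δ > 0, ∃ K : ℝ≥0, ∀ x x' : E, ∀ y y' : F, ‖y - yb‖ < δ → ‖y' - yb‖ < δ →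
      gradx Φ x y ∈ gAttentiveLoc g xb vb ε x → gradx Φ x' y' ∈ gAttentiveLoc g xb vb ε x' →
      ‖x - x'‖ ≤ K * ‖y - y'‖ := by
  obtain ⟨t, hrt, hts⟩ := exists_between hrs
  obtain ⟨δ, hδ, L, hL⟩ := hG.eventually_inner_sub_le hts hs
  obtain ⟨ε₀, hε₀, hmono⟩ := h.exists_le_inner
  refine ⟨min ε₀ δ, lt_min hε₀ hδ, δ, hδ, L / (t - r).toNNReal,
    fun x x' y y' hy hy' hx hx' => ?_⟩
  have h₁ := hmono _ (min_le_left _ _) x x' _ _ hx hx'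
  have h₂ := hL x x' y y' (hx.1.trans_le (min_le_right _ _)) (hx'.1.trans_le (min_le_right _ _))
    hy hy'
  have htr : 0 < t - r := sub_pos.2 hrt
  rw [NNReal.coe_div, Real.coe_toNNReal _ htr.le, div_mul_eq_mul_div, le_div_iff₀ htr]
  rcases (norm_nonneg (x - x')).eq_or_lt with h₀ | h₀
  · rw [← h₀, zero_mul]
    positivity
  · refine le_of_mul_le_mul_right ?_ h₀
    linarith

/-! ### The main theorem -/

theorem prox_single_valued_and_lipschitz {n m : ℕ}
    (X : Set (EuclideanSpace ℝ (Fin n))) (Y : Set (EuclideanSpace ℝ (Fin m)))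
    (Φ : EuclideanSpace ℝ (Fin n) → EuclideanSpace ℝ (Fin m) → ℝ)
    (hXcl : IsClosed X) (hXint : (interior X).Nonempty)
    (hYne : Y.Nonempty) (hYop : IsOpen Y)
    (hΦc : ContinuousOn (fun p : (EuclideanSpace ℝ (Fin n)) × (EuclideanSpace ℝ (Fin m)) => Φ p.1 p.2) (X ×ˢ Y))
    (hΦd2 : ContDiffOn ℝ 2 (fun p : (EuclideanSpace ℝ (Fin n)) × (EuclideanSpace ℝ (Fin m)) => Φ p.1 p.2) ((interior X) ×ˢ Y))
    (g : EuclideanSpace ℝ (Fin n) → EReal) (hG : AssumptionG X Y Φ g)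
    (xb vb : EuclideanSpace ℝ (Fin n)) (hxb : xb ∈ interior X)
    (r : ℝ) (hr : 0 < r) (hpr : ProxRegularAt g xb vb r)
    (yb : EuclideanSpace ℝ (Fin m)) (hyb : yb ∈ Y) (hprox : proxSet X Φ g yb = {xb})
    (hvb : vb = gradx Φ xb yb)
    (A : (EuclideanSpace ℝ (Fin n)) →L[ℝ] (EuclideanSpace ℝ (Fin n))) (hA : A = fderiv ℝ (fun x => gradx Φ x yb) xb)
    (hneg : ∀ u : EuclideanSpace ℝ (Fin n), u ≠ 0 → ⟪A u, u⟫ < 0)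
    (M : (EuclideanSpace ℝ (Fin n)) →L[ℝ] (EuclideanSpace ℝ (Fin n)))
    (hMA : M.comp A = -ContinuousLinearMap.id ℝ (EuclideanSpace ℝ (Fin n)))
    (hAM : A.comp M = -ContinuousLinearMap.id ℝ (EuclideanSpace ℝ (Fin n)))
    (lmax : ℝ) (hlmax : ∀ u : EuclideanSpace ℝ (Fin n), ⟪M u, u⟫ ≤ lmax * ‖u‖ ^ 2) (hlr : lmax < r⁻¹) :
    ∃ ε > (0 : ℝ), ∃ U ∈ 𝓝 yb, ∃ (p : EuclideanSpace ℝ (Fin m) → EuclideanSpace ℝ (Fin n)) (K : ℝ≥0),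
      (∀ y ∈ U, proxSet X Φ g y = {p y} ∧
        proxSet X Φ g y = {x | gradx Φ x y ∈ gAttentiveLoc g xb vb ε x}) ∧
      LipschitzOnWith K p U := by
  obtain ⟨γ, hγ⟩ : ∃ γ : ℝ, g xb = γ :=
    ⟨(g xb).toReal, (EReal.coe_toReal hpr.1 hpr.2.1).symm⟩
  have hxbX : xb ∈ X := interior_subset hxb
  have hC2 : ∀ x ∈ interior X, ∀ y ∈ Y, ContDiffAt ℝ 2 (fun p : (EuclideanSpace ℝ (Fin n)) ×
      (EuclideanSpace ℝ (Fin m)) => Φ p.1 p.2) (x, y) := fun x hx y hy =>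
    hΦd2.contDiffAt ((isOpen_interior.prod hYop).mem_nhds ⟨hx, hy⟩)
  have hC2x : ∀ x ∈ interior X, ∀ y ∈ Y, ContDiffAt ℝ 2 (fun x' => Φ x' y) x :=
    fun x hx y hy => (hC2 x hx y hy).comp (f := fun x' => (x', y)) x (by fun_prop)
  have hstrict := (contDiffAt_gradx (hC2 xb hxb yb hyb)).hasStrictFDerivAt (by simp)
  have hpart := hstrict.hasFDerivAt.comp (f := fun x' => (x', yb)) xb
    (hasFDerivAt_prodMk_left xb yb)
  have hA' : ∀ u, A u = fderiv ℝ (fun p : (EuclideanSpace ℝ (Fin n)) ×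
      (EuclideanSpace ℝ (Fin m)) => gradx Φ p.1 p.2) (xb, yb) (u, 0) := fun u => by
    rw [hA]
    exact DFunLike.congr_fun hpart.fderiv u
  obtain ⟨s, hrs, hsl⟩ : ∃ s, r < s ∧ s * lmax ≤ 1 := by
    rcases le_or_gt lmax 0 with hl | hl
    · exact ⟨r + 1, by linarith, by nlinarith⟩
    · exact ⟨lmax⁻¹, (lt_inv_comm₀ hr hl).2 hlr, by rw [inv_mul_cancel₀ hl.ne']⟩
  have hcoer : ∀ u, ⟪A u, u⟫ ≤ -s * ‖u‖ ^ 2 := by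
    refine inner_le_neg_mul_of_comp_eq_neg_id (fun u v => ?_) (fun u => ?_) hAM hlmax
      (hr.trans hrs).le hsl
    · rw [hA]
      exact inner_fderiv_gradx_comm (hC2x xb hxb yb hyb) hpart.differentiableAt u v
    · rcases eq_or_ne u 0 with rfl | hu
      · simp
      · exact (hneg u hu).le
  obtain ⟨ε, hε, δ, hδ, K, hK⟩ :=
    hpr.exists_gAttentiveLoc_lipschitz hstrict hrs fun u => hA' u ▸ hcoer u
  have hnear : ∀ᶠ z in 𝓝 (xb, yb), ‖gradx Φ z.1 z.2 - vb‖ < ε ∧ Φ z.1 z.2 - Φ xb z.2 < ε ∧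
      ‖z.1 - xb‖ < ε ∧ z.1 ∈ interior X := by
    have hΦn := (hC2 xb hxb yb hyb).continuousAt
    refine .and ?_ (.and ?_ (.and ?_ ?_))
    · refine (hstrict.continuousAt.sub continuousAt_const).norm.eventually_lt_const ?_
      simpa [hvb] using hε
    · refine (hΦn.sub (hΦn.comp_of_eq (f := fun z : (EuclideanSpace ℝ (Fin n)) ×
        (EuclideanSpace ℝ (Fin m)) => (xb, z.2)) (by fun_prop) rfl)).eventually_lt_const ?_
      simpa using hε
    · refine (continuousAt_fst.sub continuousAt_const).norm.eventually_lt_const ?_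
      simpa using hε
    · exact continuousAt_fst.preimage_mem_nhds (isOpen_interior.mem_nhds hxb)
  rw [nhds_prod_eq] at hnear
  obtain ⟨P, hP, Q, hQ, hPQ⟩ := eventually_prod_iff.1 hnear
  have hloc : ∀ᶠ y in 𝓝 yb, ∀ x ∈ proxSet X Φ g y,
      gradx Φ x y ∈ gAttentiveLoc g xb vb ε x := by
    filter_upwards [hQ, hYop.mem_nhds hyb,
      hG.eventually_proxSet_subset hXcl hYop hΦc hyb hγ hprox hP] with y hyQ hyY hsub x hx
    obtain ⟨hgrad, hval, hxε, hxX⟩ := hPQ (hsub hx) hyQ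
    have hle := le_of_mem_proxSet hx hxbX hγ
    have hsg := isFSubgrad_gradx_of_mem_proxSet hx hxX (ne_top_of_le_ne_top (EReal.coe_ne_top _) hle)
      (hG.ne_bot x) ((hC2x x hxX y hyY).differentiableAt (by simp))
    refine ⟨hxε, hle.trans_lt ?_, hsg.isLSubgrad, hgrad⟩
    rw [hγ, ← EReal.coe_add, EReal.coe_lt_coe_iff]
    exact add_lt_add_right hval γ
  obtain ⟨B, -, hne⟩ := hG.exists_isBounded_proxSet hXcl hYop hΦc hyb
  have hU := (hne.and hloc).and (ball_mem_nhds yb hδ)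
  have hex : ∀ y, ∃ x, (proxSet X Φ g y).Nonempty → x ∈ proxSet X Φ g y := fun y => by
    by_cases h : (proxSet X Φ g y).Nonempty
    · exact ⟨h.some, fun _ => h.some_mem⟩
    · exact ⟨0, fun h' => absurd h' h⟩
  choose p hp using hex
  refine ⟨ε, hε, _, hU, p, K, fun y hy => ?_, LipschitzOnWith.of_dist_le_mul fun y hy y' hy' => ?_⟩
  · obtain ⟨⟨⟨hy₁, -⟩, hy₂⟩, hy₃⟩ := hy
    have hyδ : ‖y - yb‖ < δ := mem_ball_iff_norm.1 hy₃
    have huniq : ∀ x, gradx Φ x y ∈ gAttentiveLoc g xb vb ε x → x = p y := fun x hx => by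
      have := hK x (p y) y y hyδ hyδ hx (hy₂ _ (hp y hy₁))
      rwa [sub_self, norm_zero, mul_zero, norm_le_zero_iff, sub_eq_zero] at this
    refine ⟨subset_antisymm (fun x hx => huniq x (hy₂ x hx)) ?_,
      subset_antisymm hy₂ fun x hx => huniq x hx ▸ hp y hy₁⟩
    rintro _ rfl
    exact hp y hy₁
  · obtain ⟨⟨⟨hy₁, -⟩, hy₂⟩, hy₃⟩ := hy
    obtain ⟨⟨⟨hy₁', -⟩, hy₂'⟩, hy₃'⟩ := hy'
    rw [dist_eq_norm, dist_eq_norm]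
    exact hK _ _ y y' (mem_ball_iff_norm.1 hy₃) (mem_ball_iff_norm.1 hy₃')
      (hy₂ _ (hp y hy₁)) (hy₂' _ (hp y' hy₁'))

end
end

section
/- Let X ⊆ ℝ^n be closed with nonempty interior, Y ⊆ ℝ^m nonempty and open, Φ : X × Y → ℝ twice continuously differentiable on int(X) × Y and continuous relative to X × Y, and let g satisfy Assumption (G). Suppose g is prox-regular at x̄ ∈ int X for v̄ ∈ ∂g(x̄) with parameter r > 0, that ȳ ∈ Y satisfies (∂_Φ g)^{-1}(ȳ) = {x̄} and v̄ = ∇_x Φ(x̄, ȳ), and that ∇²_{xx}Φ(x̄, ȳ) is negative definite with λ_max(M) < r^{-1} for M := −(∇²_{xx}Φ(x̄, ȳ))^{-1}. Let σ be the Lipschitz continuous single-valued localization around 0 for x̄ of the inverse of Q(x) := −∇_x Φ(x̄, ȳ) − ∇²_{xx}Φ(x̄, ȳ)(x − x̄) + ∂g(x), and let s be the Lipschitz continuous single-valued localization around ȳ for x̄ of the solution mapping S(y) := {x : 0 ∈ ∂g(x) − ∇_x Φ(x, y)}. Then η(y) := σ(∇²_{yx}Φ(x̄, ȳ)(y − ȳ))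 is a first-order approximation to s at ȳ; and if σ is strictly differentiable at 0, then η is a strict first-order approximation to s at ȳ. -/
set_option linter.unusedVariables false

open Filter Topology Metric Set Bornology
open scoped RealInnerProductSpace NNReal

noncomputable section

variable {E F : Type*} [NormedAddCommGroup E] [InnerProductSpace ℝ E] [CompleteSpace E]
  [NormedAddCommGroup F] [InnerProductSpace ℝ F] [CompleteSpace F]

/-- The partial gradient of a `C²` coupling is strictly differentiable in both arguments jointly. -/
theorem gradx_hasStrictFDerivAt {G : Type*} [NormedAddCommGroup G]
    [InnerProductSpace ℝ G] {Φ : E → G → ℝ} {xb : E} {yb : G}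
    (h : ContDiffAt ℝ 2 (fun p : E × G => Φ p.1 p.2) (xb, yb)) :
    ∃ D : E × G →L[ℝ] E,
      HasStrictFDerivAt (fun p : E × G => gradx Φ p.1 p.2) D (xb, yb) := by
  let riesz : (E →L[ℝ] ℝ) →L[ℝ] E :=
    { toFun := (InnerProductSpace.toDual ℝ E).symm
      map_add' := map_add _
      map_smul' := fun c f => by simp
      cont := (InnerProductSpace.toDual ℝ E).symm.continuous }
  let L : (E × G →L[ℝ] ℝ) →L[ℝ] E :=
    riesz.comp
      ((ContinuousLinearMap.compL ℝ E (E × G) ℝ).flip (ContinuousLinearMap.inl ℝ E G))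
  have hsmooth : ContDiffAt ℝ 1 (fun p : E × G => L (fderiv ℝ (fun q : E × G => Φ q.1 q.2) p))
      (xb, yb) := by
    have hderiv : ContDiffAt ℝ 1 (fderiv ℝ (fun q : E × G => Φ q.1 q.2)) (xb, yb) :=
      h.fderiv_right (by norm_num)
    exact hderiv.continuousLinearMap_comp L
  have heq : (fun p : E × G => L (fderiv ℝ (fun q : E × G => Φ q.1 q.2) p))
      =ᶠ[𝓝 (xb, yb)] fun p => gradx Φ p.1 p.2 := by
    filter_upwards [h.eventually (by simp)] with p hp
    have hd : HasFDerivAt (fun q : E × G => Φ q.1 q.2)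
        (fderiv ℝ (fun q : E × G => Φ q.1 q.2) p) (p.1, p.2) :=
      (hp.differentiableAt (by simp)).hasFDerivAt
    have hslice : HasFDerivAt (fun x' => Φ x' p.2)
        ((fderiv ℝ (fun q : E × G => Φ q.1 q.2) p).comp (ContinuousLinearMap.inl ℝ E G)) p.1 :=
      HasFDerivAt.comp (f := fun x' => (x', p.2)) p.1 hd (hasFDerivAt_prodMk_left p.1 p.2)
    simp only [gradx, gradient, hslice.fderiv]
    rfl
  exact ⟨_, ((hsmooth.congr_of_eventuallyEq heq.symm).hasStrictFDerivAt (by simp))⟩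

/-- A single-valued localization evaluates at `p` to any point of the image of `p` that is close
to the reference value. -/
theorem IsSVLocalization.eventually_eq {α β γ : Type*} [TopologicalSpace α] [TopologicalSpace β]
    {Fm : α → Set β} {pb : α} {qb : β} {σ : α → β} {U : Set α}
    (h : IsSVLocalization Fm pb qb σ U) {l : Filter γ} {u : γ → α} {q : γ → β}
    (hu : Tendsto u l (𝓝 pb)) (hq : Tendsto q l (𝓝 qb)) (hmem : ∀ᶠ c in l, q c ∈ Fm (u c)) :
    ∀ᶠ c in l, q c = σ (u c) := by
  obtain ⟨hU, -, V, hV, hval⟩ := h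
  filter_upwards [hu hU, hq hV, hmem] with c hcU hcV hc
  have : q c ∈ Fm (u c) ∩ V := ⟨hc, hcV⟩
  rwa [hval _ hcU] at this

/-- Values of a single-valued localization solve the underlying inclusion. -/
theorem IsSVLocalization.eventually_mem {α β : Type*} [TopologicalSpace α] [TopologicalSpace β]
    {Fm : α → Set β} {pb : α} {qb : β} {σ : α → β} {U : Set α}
    (h : IsSVLocalization Fm pb qb σ U) : ∀ᶠ p in 𝓝 pb, σ p ∈ Fm p := by
  obtain ⟨hU, -, V, hV, hval⟩ := h
  filter_upwards [hU] with p hp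
  have : σ p ∈ Fm p ∩ V := by rw [hval p hp]; rfl
  exact this.1

/-- A function that is Lipschitz near a point has increments of order at most one there. -/
theorem LipschitzOnWith.isBigO_sub {α β : Type*} [NormedAddCommGroup α] [NormedAddCommGroup β]
    {K : ℝ≥0} {f : α → β} {U : Set α} {a : α} (h : LipschitzOnWith K f U) (hU : U ∈ 𝓝 a) :
    (fun p : α × α => f p.1 - f p.2) =O[𝓝 (a, a)] fun p => p.1 - p.2 := by
  refine Asymptotics.IsBigO.of_bound K ?_
  filter_upwards [prod_mem_nhds hU hU] with p hp
  exact h.norm_sub_le hp.1 hp.2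

theorem first_order_approximation_of_solution_map {n m : ℕ}
    (X : Set (EuclideanSpace ℝ (Fin n))) (Y : Set (EuclideanSpace ℝ (Fin m)))
    (Φ : EuclideanSpace ℝ (Fin n) → EuclideanSpace ℝ (Fin m) → ℝ)
    (hXcl : IsClosed X) (hXint : (interior X).Nonempty)
    (hYne : Y.Nonempty) (hYop : IsOpen Y)
    (hΦc : ContinuousOn (fun p : (EuclideanSpace ℝ (Fin n)) × (EuclideanSpace ℝ (Fin m)) => Φ p.1 p.2) (X ×ˢ Y))
    (hΦd2 : ContDiffOn ℝ 2 (fun p : (EuclideanSpace ℝ (Fin n)) × (EuclideanSpace ℝ (Fin m)) => Φ p.1 p.2) ((interior X) ×ˢ Y))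
    (g : EuclideanSpace ℝ (Fin n) → EReal) (hG : AssumptionG X Y Φ g)
    (xb vb : EuclideanSpace ℝ (Fin n)) (hxb : xb ∈ interior X)
    (r : ℝ) (hr : 0 < r) (hpr : ProxRegularAt g xb vb r)
    (yb : EuclideanSpace ℝ (Fin m)) (hyb : yb ∈ Y) (hprox : proxSet X Φ g yb = {xb})
    (hvb : vb = gradx Φ xb yb)
    (A : (EuclideanSpace ℝ (Fin n)) →L[ℝ] (EuclideanSpace ℝ (Fin n))) (hA : A = fderiv ℝ (fun x => gradx Φ x yb) xb)
    (hneg : ∀ u : EuclideanSpace ℝ (Fin n), u ≠ 0 → ⟪A u, u⟫ < 0)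
    (M : (EuclideanSpace ℝ (Fin n)) →L[ℝ] (EuclideanSpace ℝ (Fin n)))
    (hMA : M.comp A = -ContinuousLinearMap.id ℝ (EuclideanSpace ℝ (Fin n)))
    (hAM : A.comp M = -ContinuousLinearMap.id ℝ (EuclideanSpace ℝ (Fin n)))
    (lmax : ℝ) (hlmax : ∀ u : EuclideanSpace ℝ (Fin n), ⟪M u, u⟫ ≤ lmax * ‖u‖ ^ 2) (hlr : lmax < r⁻¹)
    (B : (EuclideanSpace ℝ (Fin m)) →L[ℝ] (EuclideanSpace ℝ (Fin n))) (hB : B = fderiv ℝ (fun y => gradx Φ xb y) yb)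
    (σ : EuclideanSpace ℝ (Fin n) → EuclideanSpace ℝ (Fin n)) (Uσ : Set (EuclideanSpace ℝ (Fin n))) (Kσ : ℝ≥0)
    (hσ : IsSVLocalization (fun u => {x | ∃ v, IsLSubgrad g x v ∧
        -(gradx Φ xb yb) - A (x - xb) + v = u}) 0 xb σ Uσ)
    (hσl : LipschitzOnWith Kσ σ Uσ)
    (s : EuclideanSpace ℝ (Fin m) → EuclideanSpace ℝ (Fin n)) (Us : Set (EuclideanSpace ℝ (Fin m))) (Ks : ℝ≥0)
    (hs : IsSVLocalization (fun y => {x | IsLSubgrad g x (gradx Φ x y)}) yb xb s Us)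
    (hsl : LipschitzOnWith Ks s Us) :
    IsFOApprox s (fun y => σ (B (y - yb))) yb ∧
    ((∃ Aσ : (EuclideanSpace ℝ (Fin n)) →L[ℝ] (EuclideanSpace ℝ (Fin n)), HasStrictFDerivAt σ Aσ 0) →
      IsStrictFOApprox s (fun y => σ (B (y - yb))) yb) := by
  have hcd : ContDiffAt ℝ 2 (fun p : (EuclideanSpace ℝ (Fin n)) × (EuclideanSpace ℝ (Fin m)) =>
      Φ p.1 p.2) (xb, yb) :=
    hΦd2.contDiffAt ((isOpen_interior.prod hYop).mem_nhds ⟨hxb, hyb⟩)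
  obtain ⟨D, hD⟩ := gradx_hasStrictFDerivAt hcd
  have hDA : D.comp (ContinuousLinearMap.inl ℝ _ _) = A := by
    rw [hA]
    exact (HasFDerivAt.comp (f := fun x => (x, yb)) xb hD.hasFDerivAt (hasFDerivAt_prodMk_left xb yb)).fderiv.symm
  have hDB : D.comp (ContinuousLinearMap.inr ℝ _ _) = B := by
    rw [hB]
    exact (HasFDerivAt.comp (f := fun y => (xb, y)) yb hD.hasFDerivAt (hasFDerivAt_prodMk_right xb yb)).fderiv.symm
  have hDeq : ∀ a b, D (a, b) = A a + B b := by
    intro a b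
    rw [← hDA, ← hDB]
    simp [← map_add]
  have hsb : s yb = xb := hs.2.1
  have hsO := hsl.isBigO_sub hs.1
  have hscont : Tendsto s (𝓝 yb) (𝓝 xb) := by
    rw [← hsb]
    exact hsl.continuousOn.continuousAt hs.1
  -- The residual `u` satisfies `s y ∈ Q⁻¹ (u y)`; its linearization is `w`.
  set u : EuclideanSpace ℝ (Fin m) → EuclideanSpace ℝ (Fin n) := fun y =>
    -(gradx Φ xb yb) - A (s y - xb) + gradx Φ (s y) y with hu
  set w : EuclideanSpace ℝ (Fin m) → EuclideanSpace ℝ (Fin n) := fun y => B (y - yb) with hw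
  have hub : u yb = 0 := by simp [hu, hsb]
  have hwb : w yb = 0 := by simp [hw]
  have hut : Tendsto u (𝓝 yb) (𝓝 0) := by
    have h1 : Tendsto (fun y => gradx Φ (s y) y) (𝓝 yb) (𝓝 (gradx Φ xb yb)) :=
      hD.continuousAt.tendsto.comp (hscont.prodMk_nhds tendsto_id)
    have h2 : Tendsto (fun y => A (s y - xb)) (𝓝 yb) (𝓝 (A (xb - xb))) :=
      (A.continuous.tendsto _).comp (hscont.sub_const xb)
    simpa [hu] using (h2.const_sub (-(gradx Φ xb yb))).add h1
  have hwt : Tendsto w (𝓝 yb) (𝓝 0) := by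
    have : Continuous w := by fun_prop
    simpa [hwb] using this.tendsto yb
  have hsσ : ∀ᶠ y in 𝓝 yb, s y = σ (u y) :=
    hσ.eventually_eq hut hscont (hs.eventually_mem.mono fun y hy => ⟨_, hy, rfl⟩)
  have hT : (fun p : EuclideanSpace ℝ (Fin m) × EuclideanSpace ℝ (Fin m) =>
      (u p.1 - w p.1) - (u p.2 - w p.2)) =o[𝓝 (yb, yb)] fun p => p.1 - p.2 := by
    have hpt : Tendsto (fun y => (s y, y)) (𝓝 yb) (𝓝 (xb, yb)) :=
      hscont.prodMk_nhds tendsto_id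
    have hpair : Tendsto (fun p : EuclideanSpace ℝ (Fin m) × EuclideanSpace ℝ (Fin m) =>
        ((s p.1, p.1), (s p.2, p.2))) (𝓝 (yb, yb)) (𝓝 ((xb, yb), (xb, yb))) :=
      (hpt.comp (continuous_fst.tendsto (yb, yb))).prodMk_nhds
        (hpt.comp (continuous_snd.tendsto (yb, yb)))
    have ho := (hD.isLittleO.comp_tendsto hpair).trans_isBigO
      (hsO.prod_left (Asymptotics.isBigO_refl _ _))
    refine ho.congr_left fun p => ?_
    simp only [Function.comp, Prod.mk_sub_mk, hDeq, hu, hw, map_sub]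
    abel
  have hb : σ (w yb) = s yb := by rw [hwb, hsb, hσ.2.1]
  refine ⟨⟨hb, fun ε hε => ?_⟩, fun ⟨Aσ, hAσ⟩ => ⟨hb, fun ε hε => ?_⟩⟩
  · have hdiag : Tendsto (fun y => (y, yb)) (𝓝 yb) (𝓝 (yb, yb)) :=
      tendsto_id.prodMk_nhds tendsto_const_nhds
    have h1 : (fun y => u y - w y) =o[𝓝 yb] fun y => y - yb := by
      simpa [Function.comp_def, hub, hwb] using hT.comp_tendsto hdiag
    have h2 : (fun y => σ (u y) - σ (w y)) =O[𝓝 yb] fun y => u y - w y :=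
      (hσl.isBigO_sub hσ.1).comp_tendsto (hut.prodMk_nhds hwt)
    have h3 := (h2.trans_isLittleO h1).def hε
    refine ⟨_, hsσ.and h3, fun y hy => ?_⟩
    rw [hy.1]
    exact hy.2
  · have hwO : (fun p : EuclideanSpace ℝ (Fin m) × EuclideanSpace ℝ (Fin m) => w p.1 - w p.2)
        =O[𝓝 (yb, yb)] fun p => p.1 - p.2 := by
      refine (B.isBigO_comp (fun p : EuclideanSpace ℝ (Fin m) ×
        EuclideanSpace ℝ (Fin m) => p.1 - p.2) _).congr_left fun p => ?_
      simp [hw]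
    have huO : (fun p : EuclideanSpace ℝ (Fin m) × EuclideanSpace ℝ (Fin m) => u p.1 - u p.2)
        =O[𝓝 (yb, yb)] fun p => p.1 - p.2 := by
      refine (hT.isBigO.add hwO).congr_left fun p => ?_
      abel
    have hfst := continuous_fst.tendsto (yb, yb)
    have hsnd := continuous_snd.tendsto (yb, yb)
    have h1 := (hAσ.isLittleO.comp_tendsto
      ((hut.comp hfst).prodMk_nhds (hut.comp hsnd))).trans_isBigO huO
    have h2 := (hAσ.isLittleO.comp_tendsto
      ((hwt.comp hfst).prodMk_nhds (hwt.comp hsnd))).trans_isBigO hwO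
    have h3 := (Aσ.isBigO_comp _ _).trans_isLittleO hT
    have h4 : (fun p : EuclideanSpace ℝ (Fin m) × EuclideanSpace ℝ (Fin m) =>
        σ (u p.1) - σ (w p.1) - (σ (u p.2) - σ (w p.2))) =o[𝓝 (yb, yb)] fun p => p.1 - p.2 := by
      refine ((h1.sub h2).add h3).congr_left fun p => ?_
      simp only [Function.comp, map_sub]
      abel
    have h5 := h4.def hε
    obtain ⟨V, hV, hVb⟩ : ∃ V ∈ 𝓝 yb, ∀ y ∈ V, ∀ y' ∈ V,
        ‖σ (u y) - σ (w y) - (σ (u y') - σ (w y'))‖ ≤ ε * ‖y - y'‖ := by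
      rw [nhds_prod_eq] at h5
      obtain ⟨V, hV, hVb⟩ := mem_prod_self_iff.1 h5
      refine ⟨V, hV, fun y hy y' hy' => ?_⟩
      have hmem := hVb (Set.mk_mem_prod hy hy')
      rwa [Set.mem_ofPred_eq] at hmem
    refine ⟨V ∩ {y | s y = σ (u y)}, inter_mem hV hsσ, fun y hy y' hy' => ?_⟩
    have hyy := hVb y hy.1 y' hy'.1
    have hsy : s y = σ (u y) := hy.2
    have hsy' : s y' = σ (u y') := hy'.2
    rwa [← hsy, ← hsy'] at hyy

end
end
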